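/- arXiv:2502.08462 — 2 statements merged into one kernel-verified Lean document; each statement's English description precedes it below -/
import Mathlib

section
/- For every integer k > 2 and every c > 0 there exists δ > 0 such that, with high probability, every k-deeply connected component of the uniform random graph G(n, ⌈cn⌉) is either a single vertex or contains at least δn vertices. -/
open MeasureTheory Filter

noncomputable section

/-- `∑_{i ≥ k} x^i / i!`. -/
noncomputable def sumFrom (k : ℕ) (x : ℝ) : ℝ :=
  ∑' i : ℕ, if k ≤ i then x ^ i / (Nat.factorial i) else 0

/-- `π_k(x) = Pr[Pois(x) ≥ k] = ∑_{i ≥ k} x^i e^{-x} / i!`. -/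
noncomputable def ptail (k : ℕ) (x : ℝ) : ℝ :=
  ∑' i : ℕ, if k ≤ i then x ^ i * Real.exp (-x) / (Nat.factorial i) else 0

/-- `c` is the positive root of `c · (∑_{i≥k−1}(2c)^i/i!)/(∑_{i≥k}(2c)^i/i!) = k`,
i.e. the constant `c'_k`. -/
def IsCkPrime (k : ℕ) (c : ℝ) : Prop :=
  0 < c ∧ c * sumFrom (k - 1) (2 * c) = k * sumFrom k (2 * c)

/-- `lam` is the largest root `λ` of `c = λ / π_{j-1}(λ)`, i.e. of `λ = c · π_{j-1}(λ)`. -/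
def IsLambda (j : ℕ) (c lam : ℝ) : Prop :=
  lam = c * ptail (j - 1) lam ∧ ∀ mu : ℝ, mu = c * ptail (j - 1) mu → mu ≤ lam

/-- `b` is the largest root `β` of the equation `β = Pr[Pois(βc) ≥ k]`. -/
def IsBetaVal (k : ℕ) (c b : ℝ) : Prop :=
  b = ptail k (b * c) ∧ ∀ b' : ℝ, b' = ptail k (b' * c) → b' ≤ b

/-- A set of edges is a spanning tree (on the whole vertex type `V`) if the graph it
spans is connected and acyclic. -/
def IsSpanningTreeSet {V : Type*} (T : Set (Sym2 V)) : Prop :=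
  (SimpleGraph.fromEdgeSet T).Connected ∧ (SimpleGraph.fromEdgeSet T).IsAcyclic

/-- A graph is `k`-deeply connected if it contains `k` pairwise edge-disjoint
spanning trees. -/
def DeeplyConnected {V : Type*} (k : ℕ) (G : SimpleGraph V) : Prop :=
  ∃ T : Fin k → Set (Sym2 V),
    (∀ i, T i ⊆ G.edgeSet) ∧ (∀ i, IsSpanningTreeSet (T i)) ∧
    Pairwise fun i j => Disjoint (T i) (T j)

/-- A `k`-deeply connected component: a vertex set inducing a `k`-deeply connected
subgraph, maximal by inclusion with this property. -/
def DeepComponent {V : Type*} (k : ℕ) (G : SimpleGraph V) (C : Set V) : Prop :=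
  DeeplyConnected k (G.induce C) ∧
    ∀ C' : Set V, C ⊆ C' → DeeplyConnected k (G.induce C') → C' = C

/-- The `κ`-core of a graph: the largest vertex set each of whose vertices has at
least `κ` neighbours inside the set. -/
def coreSet {V : Type*} (κ : ℕ) (G : SimpleGraph V) : Set V :=
  ⋃₀ {C : Set V | ∀ v ∈ C, κ ≤ (C ∩ G.neighborSet v).ncard}

/-- `E` can be written as a disjoint union of `k` forests. -/
def PartitionsIntoForests {V : Type*} (k : ℕ) (E : Finset (Sym2 V)) : Prop :=
  ∃ F : Fin k → Finset (Sym2 V),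
    (∀ i, F i ⊆ E) ∧ (∀ e ∈ E, ∃ i, e ∈ F i) ∧
    (Pairwise fun i j => Disjoint (F i) (F j)) ∧
    ∀ i, (SimpleGraph.fromEdgeSet (↑(F i) : Set (Sym2 V))).IsAcyclic

/-- The rank of an edge set in the union matroid `M^k` of `k` copies of the graphic
matroid: the largest cardinality of a subset that splits into `k` forests. -/
noncomputable def rkk {V : Type*} (k : ℕ) (E : Set (Sym2 V)) : ℕ :=
  sSup {m : ℕ | ∃ F : Finset (Sym2 V), ↑F ⊆ E ∧ PartitionsIntoForests k F ∧ F.card = m}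

/-- The edges of `S` with both endpoints in `U`. -/
def edgesIn {V : Type*} (S : Set (Sym2 V)) (U : Set V) : Set (Sym2 V) :=
  {e | e ∈ S ∧ ∀ v ∈ e, v ∈ U}

instance measFinset {n : ℕ} : MeasurableSpace (Finset (Sym2 (Fin n))) := ⊤

/-- The `m`-element sets of non-loop edges of `K_n`. -/
def graphEdgeSets (n m : ℕ) : Finset (Finset (Sym2 (Fin n))) :=
  Finset.univ.filter fun S => S.card = m ∧ ∀ e ∈ S, ¬ e.IsDiag

/-- The uniform random graph `G(n,m)`, as a measure on edge sets. -/
noncomputable def gnm (n m : ℕ) : Measure (Finset (Sym2 (Fin n))) :=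
  ((graphEdgeSets n m).card : ENNReal)⁻¹ • ∑ S ∈ graphEdgeSets n m, Measure.dirac S

/-- The binomial random graph `G(n,p)`, as a measure on edge sets. -/
noncomputable def gnp (n : ℕ) (p : ℝ) : Measure (Finset (Sym2 (Fin n))) :=
  ∑ S ∈ (Finset.univ.filter fun S : Finset (Sym2 (Fin n)) => ∀ e ∈ S, ¬ e.IsDiag),
    ENNReal.ofReal (p ^ S.card * (1 - p) ^ (n.choose 2 - S.card)) • Measure.dirac S

/-- The graph spanned by a finite set of edges. -/
def graphOf {n : ℕ} (S : Finset (Sym2 (Fin n))) : SimpleGraph (Fin n) :=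
  SimpleGraph.fromEdgeSet (↑S : Set (Sym2 (Fin n)))

instance measProc {n : ℕ} : MeasurableSpace (Fin (n.choose 2) → Sym2 (Fin n)) := ⊤

/-- Enumerations of the edges of `K_n` in some order: the sample space of the
random graph process. -/
def procSet (n : ℕ) : Finset (Fin (n.choose 2) → Sym2 (Fin n)) :=
  Finset.univ.filter fun f => Function.Injective f ∧ ∀ i, ¬ (f i).IsDiag

/-- The random graph process: a uniformly random enumeration of the edges of `K_n`. -/
noncomputable def procMeasure (n : ℕ) : Measure (Fin (n.choose 2) → Sym2 (Fin n)) :=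
  ((procSet n).card : ENNReal)⁻¹ • ∑ f ∈ procSet n, Measure.dirac f

/-- The first `m` edges of the process `f`, i.e. the edge set of `G_m`. -/
def edgesUpTo (n : ℕ) (f : Fin (n.choose 2) → Sym2 (Fin n)) (m : ℕ) : Set (Sym2 (Fin n)) :=
  {e | ∃ i : Fin (n.choose 2), (i : ℕ) < m ∧ f i = e}

/-- The non-loop edges of `K_n`, i.e. the index set of i.i.d. edge weights. -/
abbrev EdgeType (n : ℕ) : Type := {e : Sym2 (Fin n) // ¬ e.IsDiag}

/-- The minimum total weight of a union of `k` pairwise edge-disjoint spanning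
trees of the complete graph `K_n` with edge weights `w`. -/
noncomputable def minTreesWeight (k n : ℕ) (w : EdgeType n → ℝ) : ℝ :=
  sInf {W : ℝ | ∃ T : Fin k → Finset (EdgeType n),
    (∀ i, IsSpanningTreeSet (Subtype.val '' (↑(T i) : Set (EdgeType n)))) ∧
    (Pairwise fun i j => Disjoint (T i) (T j)) ∧
    W = ∑ i : Fin k, ∑ e ∈ T i, w e}

/-- The sum over all non-trivial `k`-deeply connected components `C` of `G_m`
of `(|C|/n)²`, in the random graph process `f`. -/
noncomputable def sqSum (k n : ℕ) (f : Fin (n.choose 2) → Sym2 (Fin n)) (m : ℕ) : ℝ :=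
  ∑ᶠ C ∈ {C : Set (Fin n) |
      DeepComponent k (SimpleGraph.fromEdgeSet (edgesUpTo n f m)) C ∧ 2 ≤ C.ncard},
    ((C.ncard : ℝ) / n) ^ 2

/-- The rank increment `𝕀_i = rk_k(G_i) − rk_k(G_{i−1})` in the random graph process. -/
noncomputable def rkInc (k n : ℕ) (i : ℕ) (f : Fin (n.choose 2) → Sym2 (Fin n)) : ℝ :=
  (rkk k (edgesUpTo n f i) : ℝ) - (rkk k (edgesUpTo n f (i - 1)) : ℝ)

/-- `𝒫'_i`: the conditional expectation of `𝕀_i` given the first `i−1` edges. -/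
noncomputable def condP (k n : ℕ) (i : ℕ) : (Fin (n.choose 2) → Sym2 (Fin n)) → ℝ :=
  MeasureTheory.condExp
    (MeasurableSpace.comap (fun f => (List.ofFn f).take (i - 1)) (⊤ : MeasurableSpace (List (Sym2 (Fin n)))))
    (procMeasure n) (rkInc k n i)

/-- The rank function of a matroid: the largest size of an independent subset. -/
noncomputable def matRank {α : Type*} (M : Matroid α) (X : Set α) : ℕ :=
  sSup {m : ℕ | ∃ I ⊆ X, M.Indep I ∧ I.ncard = m}

end

open Finset in
lemma aux_choose_ratio (t : ℕ) : ∀ m N : ℕ, t ≤ m → m ≤ N →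
    (((N - t).choose (m - t) : ℕ) : ℝ) ≤ (N.choose m : ℝ) * ((m : ℝ) / N) ^ t := by
  induction t with
  | zero => intro m N _ _; simp
  | succ t ih =>
    intro m N h1 h2
    obtain ⟨m, rfl⟩ : ∃ m', m = m' + 1 := ⟨m - 1, by omega⟩
    obtain ⟨N, rfl⟩ : ∃ m', N = m' + 1 := ⟨N - 1, by omega⟩
    have h := ih m N (by omega) (by omega)
    rw [Nat.add_sub_add_right, Nat.add_sub_add_right]
    refine h.trans ?_
    have hmN : (m : ℝ) ≤ N := by exact_mod_cast (by omega : m ≤ N)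
    have hr : (m : ℝ) / N ≤ ((m + 1 : ℕ) : ℝ) / ((N + 1 : ℕ) : ℝ) := by
      rcases Nat.eq_zero_or_pos N with h0 | h0
      · subst h0; simp; positivity
      · have : (0 : ℝ) < N := by exact_mod_cast h0
        push_cast
        rw [div_le_div_iff₀ this (by positivity)]
        nlinarith
    have he : (N.choose m : ℝ) = ((N + 1).choose (m + 1) : ℝ) * (((m + 1 : ℕ) : ℝ) / ((N + 1 : ℕ) : ℝ)) := by
      have := Nat.add_one_mul_choose_eq N m
      have h3 : ((N + 1 : ℕ) : ℝ) * (N.choose m : ℝ) = ((N + 1).choose (m + 1) : ℝ) * ((m + 1 : ℕ) : ℝ) := by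
        exact_mod_cast this
      have h4 : ((N + 1 : ℕ) : ℝ) ≠ 0 := by positivity
      field_simp
      linarith
    calc (N.choose m : ℝ) * ((m : ℝ) / N) ^ t
        ≤ (N.choose m : ℝ) * (((m + 1 : ℕ) : ℝ) / ((N + 1 : ℕ) : ℝ)) ^ t := by gcongr
      _ = _ := by rw [he, pow_succ]; ring

lemma aux_count {α : Type*} [DecidableEq α] (E T : Finset α) (m : ℕ) (hT : T ⊆ E) (hm : m ≤ E.card) :
    (((E.powersetCard m).filter (fun S => T ⊆ S)).card : ℝ)
      ≤ (E.card.choose m : ℝ) * ((m : ℝ) / E.card) ^ T.card := by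
  by_cases htm : T.card ≤ m
  · refine le_trans ?_ (aux_choose_ratio T.card m E.card htm hm)
    have : ((E.powersetCard m).filter (fun S => T ⊆ S)).card
        ≤ ((E \ T).powersetCard (m - T.card)).card := by
      apply Finset.card_le_card_of_injOn (fun S => S \ T)
      · intro S hS
        simp only [Finset.coe_filter, Finset.mem_powersetCard, Set.mem_ofPred_eq] at hS
        simp only [Finset.mem_coe, Finset.mem_powersetCard]
        refine ⟨Finset.sdiff_subset_sdiff hS.1.1 le_rfl, ?_⟩
        rw [Finset.card_sdiff_of_subset hS.2, hS.1.2]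
      · intro S hS S' hS' h
        simp only [Finset.coe_filter, Finset.mem_powersetCard, Set.mem_ofPred_eq] at hS hS'
        simp only at h
        rw [← Finset.sdiff_union_of_subset hS.2, h, Finset.sdiff_union_of_subset hS'.2]
    rw [Finset.card_powersetCard, Finset.card_sdiff_of_subset hT] at this
    exact_mod_cast this
  · rw [Finset.filter_eq_empty_iff.2]
    · simp; positivity
    · intro S hS hTS
      rw [Finset.mem_powersetCard] at hS
      have := Finset.card_le_card hTS
      omega

/-- Non-loop pairs inside `U`. -/
def auxE {n : ℕ} (U : Finset (Fin n)) : Finset (Sym2 (Fin n)) :=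
  U.offDiag.image Sym2.mk.uncurry

lemma aux_mem_E {n : ℕ} (U : Finset (Fin n)) (e : Sym2 (Fin n)) :
    e ∈ auxE U ↔ ¬ e.IsDiag ∧ ∀ v ∈ e, v ∈ U := by
  induction e with
  | _ a b =>
    simp only [auxE, Finset.mem_image, Finset.mem_offDiag, Prod.exists, Function.uncurry]
    constructor
    · rintro ⟨x, y, ⟨hx, hy, hxy⟩, h⟩
      rw [← h]
      simp [hx, hy, hxy]
    · rintro ⟨h1, h2⟩
      exact ⟨a, b, ⟨h2 a (by simp), h2 b (by simp), by simpa using h1⟩, rfl⟩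

lemma aux_card_E {n : ℕ} (U : Finset (Fin n)) : (auxE U).card = U.card.choose 2 :=
  Sym2.card_image_offDiag U

lemma aux_graphEdgeSets (n m : ℕ) :
    graphEdgeSets n m = (auxE (Finset.univ : Finset (Fin n))).powersetCard m := by
  ext S
  simp only [graphEdgeSets, Finset.mem_filter, Finset.mem_univ, true_and, Finset.mem_powersetCard,
    Finset.subset_iff, aux_mem_E, implies_true, and_true]
  tauto

/-- The structural part. -/
lemma aux_deep {n k : ℕ} (hk : 2 < k) (S : Finset (Sym2 (Fin n))) (C : Set (Fin n))
    (h : DeeplyConnected k ((graphOf S).induce C)) :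
    ∃ U : Finset (Fin n), U.card = C.ncard ∧ 1 ≤ U.card ∧
      ∃ T ∈ (auxE U).powersetCard (3 * (U.card - 1)), T ⊆ S := by
  classical
  obtain ⟨T, hT, hspan, hdisj⟩ := h
  refine ⟨C.toFinset, (Set.ncard_eq_toFinset_card' C).symm, ?_, ?_⟩
  · have := (hspan ⟨0, by omega⟩).1.nonempty
    rw [Nat.succ_le_iff, Finset.card_pos, Set.toFinset_nonempty]
    exact Set.nonempty_coe_sort.1 this
  · let F : Fin k → Finset (Sym2 (Fin n)) := fun i => (T i).toFinset.image (Sym2.map Subtype.val)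
    have hinj : Function.Injective (Sym2.map (Subtype.val : C → Fin n)) :=
      Sym2.map.injective Subtype.val_injective
    have hFc : ∀ i, C.toFinset.card - 1 ≤ (F i).card := by
      intro i
      have h1 := (hspan i).1.card_vert_le_card_edgeSet_add_one
      rw [Finset.card_image_of_injective _ hinj]
      have h2 : Nat.card (SimpleGraph.fromEdgeSet (T i)).edgeSet ≤ (T i).toFinset.card := by
        rw [Nat.card_coe_set_eq, ← Set.ncard_eq_toFinset_card']
        apply Set.ncard_le_ncard _ (Set.toFinite _)
        rw [SimpleGraph.edgeSet_fromEdgeSet]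
        exact Set.diff_subset
      have h3 : Nat.card C = C.toFinset.card := by
        rw [Nat.card_coe_set_eq, Set.ncard_eq_toFinset_card']
      omega
    have hFd : ∀ i j, i ≠ j → Disjoint (F i) (F j) := by
      intro i j hij
      rw [Finset.disjoint_image hinj]
      exact Set.disjoint_toFinset.2 (hdisj hij)
    have hFS : ∀ i, F i ⊆ S ∧ F i ⊆ auxE C.toFinset := by
      intro i
      have key : ∀ e ∈ T i, Sym2.map (Subtype.val : C → Fin n) e ∈ S ∧
          Sym2.map (Subtype.val : C → Fin n) e ∈ auxE C.toFinset := by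
        intro e he
        have := hT i he
        induction e with
        | _ a b =>
          simp only [SimpleGraph.mem_edgeSet, SimpleGraph.comap_adj, graphOf,
            SimpleGraph.fromEdgeSet_adj] at this
          rw [aux_mem_E]
          simp only [Sym2.map_mk]
          refine ⟨by simpa using this.1, by simpa using this.2, ?_⟩
          simp
      constructor <;> intro e he <;> simp only [F, Finset.mem_image, Set.mem_toFinset] at he <;>
        obtain ⟨e', he', rfl⟩ := he
      · exact (key e' he').1
      · exact (key e' he').2
    let i0 : Fin k := ⟨0, by omega⟩
    let i1 : Fin k := ⟨1, by omega⟩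
    let i2 : Fin k := ⟨2, by omega⟩
    have hcard : 3 * (C.toFinset.card - 1) ≤ ((F i0 ∪ F i1) ∪ F i2).card := by
      rw [Finset.card_union_of_disjoint, Finset.card_union_of_disjoint]
      · have := hFc i0
        have := hFc i1
        have := hFc i2
        omega
      · exact hFd _ _ (by simp [i0, i1])
      · rw [Finset.disjoint_union_left]
        exact ⟨hFd _ _ (by simp [i0, i2]), hFd _ _ (by simp [i1, i2])⟩
    obtain ⟨R, hR, hRc⟩ := Finset.exists_subset_card_eq hcard
    refine ⟨R, Finset.mem_powersetCard.2 ⟨hR.trans ?_, hRc⟩, hR.trans ?_⟩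
    · exact Finset.union_subset (Finset.union_subset (hFS _).2 (hFS _).2) (hFS _).2
    · exact Finset.union_subset (Finset.union_subset (hFS _).1 (hFS _).1) (hFS _).1

lemma aux_choose_le (M t : ℕ) (ht : 0 < t) : (M.choose t : ℝ) ≤ (3 * M / t) ^ t := by
  have h1 : (M.choose t : ℝ) ≤ (M : ℝ) ^ t / (t.factorial : ℝ) := Nat.choose_le_pow_div t M
  have h2 : (t : ℝ) ^ t / (t.factorial : ℝ) ≤ Real.exp t :=
    Real.pow_div_factorial_le_exp _ (by positivity) _
  have h3 : Real.exp t ≤ 3 ^ t := by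
    rw [← mul_one (t : ℝ), Real.exp_nat_mul]
    have := Real.exp_one_lt_d9
    gcongr
    linarith
  have ht' : (0 : ℝ) < t := by exact_mod_cast ht
  calc (M.choose t : ℝ) ≤ (M : ℝ) ^ t / (t.factorial : ℝ) := h1
    _ = (M / t : ℝ) ^ t * ((t : ℝ) ^ t / (t.factorial : ℝ)) := by
        rw [div_pow]; field_simp
    _ ≤ (M / t : ℝ) ^ t * 3 ^ t := by gcongr; linarith
    _ = _ := by rw [← mul_pow]; congr 1; ring

lemma aux_term (n s : ℕ) (B δ p : ℝ) (hB : 1 ≤ B) (hn : 0 < n) (hs : 2 ≤ s)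
    (hp0 : 0 ≤ p) (hp : p ≤ B / n)
    (hδ : 3 * B ^ 3 * δ ^ 2 ≤ 1 / 2) (hsn : (s : ℝ) ≤ δ * n) :
    (n.choose s : ℝ) * (((s.choose 2).choose (3 * (s - 1)) : ℝ) * p ^ (3 * (s - 1)))
      ≤ 4 * (3 * B ^ 3) ^ 2 / n * (s * (1 / 2) ^ s) := by
  obtain ⟨r, rfl⟩ : ∃ r, s = r + 2 := ⟨s - 2, by omega⟩
  have hn' : (0 : ℝ) < n := by exact_mod_cast hn
  have e1 : r + 2 - 1 = r + 1 := by omega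
  rw [e1]
  set x : ℝ := ((r + 2 : ℕ) : ℝ) / n with hx
  have hs0 : (0 : ℝ) < ((r + 2 : ℕ) : ℝ) := by positivity
  have hx0 : 0 < x := by positivity
  have hxδ : x ≤ δ := by rw [hx, div_le_iff₀ hn']; exact hsn
  have a1 : (n.choose (r + 2) : ℝ) ≤ (3 / x) ^ (r + 2) := by
    refine (aux_choose_le n (r + 2) (by omega)).trans (le_of_eq ?_)
    congr 1
    rw [hx]; field_simp
  have a2 : (((r + 2).choose 2).choose (3 * (r + 1)) : ℝ) ≤ ((r + 2 : ℕ) : ℝ) ^ (3 * (r + 1)) := by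
    refine (aux_choose_le _ _ (by omega)).trans ?_
    have : (((r + 2).choose 2 : ℕ) : ℝ) = (r + 2) * (r + 1) / 2 := by
      rw [Nat.cast_choose_two]; push_cast; ring
    gcongr
    rw [this]
    push_cast
    rw [div_le_iff₀ (by positivity)]
    nlinarith [show (0 : ℝ) ≤ r from by positivity]
  have a3 : p ^ (3 * (r + 1)) ≤ (B / n) ^ (3 * (r + 1)) := by gcongr
  have a4 : 3 * B ^ 3 * x ^ 2 ≤ 1 / 2 := by
    refine le_trans ?_ hδ
    gcongr
  calc _ ≤ (3 / x) ^ (r + 2) * (((r + 2 : ℕ) : ℝ) ^ (3 * (r + 1)) * (B / n) ^ (3 * (r + 1))) := by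
        gcongr
    _ = (3 / x) ^ (r + 2) * (B * x) ^ (3 * (r + 1)) := by
        rw [← mul_pow, hx]; congr 2; ring
    _ = 3 ^ (r + 2) * B ^ (3 * (r + 1)) * (x ^ (2 * r) * x) := by
        rw [div_pow, mul_pow]
        have : x ^ (3 * (r + 1)) = x ^ (r + 2) * (x ^ (2 * r) * x) := by
          rw [← pow_succ, ← pow_add]; congr 1; ring
        rw [this]; field_simp
    _ ≤ 3 ^ (r + 2) * B ^ (3 * (r + 2)) * (x ^ (2 * r) * x) := by
        have : B ^ (3 * (r + 1)) ≤ B ^ (3 * (r + 2)) := pow_le_pow_right₀ hB (by omega)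
        gcongr
    _ = (3 * B ^ 3) ^ 2 * x * (3 * B ^ 3 * x ^ 2) ^ r := by
        rw [pow_mul B, pow_mul x, mul_pow _ (x ^ 2), mul_pow 3 (B ^ 3), pow_add, pow_add, mul_pow]; ring
    _ ≤ (3 * B ^ 3) ^ 2 * x * (1 / 2) ^ r := by gcongr
    _ = _ := by rw [hx, pow_add]; field_simp; norm_num

lemma aux_sum (n : ℕ) : ∑ s ∈ Finset.range n, ((s : ℝ) * (1 / 2) ^ s) = 2 - 2 * (n + 1) * (1 / 2) ^ n := by
  induction n with
  | zero => simp
  | succ n ih => rw [Finset.sum_range_succ, ih, pow_succ]; push_cast; ring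

open Classical in
lemma aux_bad (k : ℕ) (hk : 2 < k) (n m : ℕ) (B δ : ℝ) (hB : 1 ≤ B) (hn : 0 < n)
    (hm : m ≤ n.choose 2) (hp : (m : ℝ) / (n.choose 2 : ℕ) ≤ B / n)
    (hδ : 3 * B ^ 3 * δ ^ 2 ≤ 1 / 2) :
    (((graphEdgeSets n m).filter (fun S => ¬ ∀ C : Set (Fin n),
          DeepComponent k (graphOf S) C → C.ncard = 1 ∨ δ * n ≤ (C.ncard : ℝ))).card : ℝ)
      ≤ (graphEdgeSets n m).card * (8 * (3 * B ^ 3) ^ 2 / n) := by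
  set p : ℝ := (m : ℝ) / (n.choose 2 : ℕ) with hpdef
  have hp0 : 0 ≤ p := by positivity
  set X : Finset (Finset (Fin n)) :=
    Finset.univ.powerset.filter (fun U => 2 ≤ U.card ∧ (U.card : ℝ) ≤ δ * n) with hX
  have hEc : (auxE (Finset.univ : Finset (Fin n))).card = n.choose 2 := by
    rw [aux_card_E]; simp
  have hsub : (graphEdgeSets n m).filter (fun S => ¬ ∀ C : Set (Fin n),
          DeepComponent k (graphOf S) C → C.ncard = 1 ∨ δ * n ≤ (C.ncard : ℝ))
      ⊆ X.biUnion (fun U => ((auxE U).powersetCard (3 * (U.card - 1))).biUnion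
          (fun T => (graphEdgeSets n m).filter (fun S => T ⊆ S))) := by
    intro S hS
    rw [Finset.mem_filter] at hS
    obtain ⟨hS, hb⟩ := hS
    push Not at hb
    obtain ⟨C, hC, h1, h2⟩ := hb
    obtain ⟨U, hU, hU1, T, hT, hTS⟩ := aux_deep hk S C hC.1
    simp only [Finset.mem_biUnion]
    refine ⟨U, ?_, T, hT, Finset.mem_filter.2 ⟨hS, hTS⟩⟩
    rw [hX, Finset.mem_filter]
    refine ⟨by simp, by omega, ?_⟩
    rw [hU]; exact h2.le
  have hGc : (graphEdgeSets n m).card = (n.choose 2).choose m := by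
    rw [aux_graphEdgeSets, Finset.card_powersetCard, hEc]
  have hcnt : ∀ U : Finset (Fin n), ∀ T ∈ (auxE U).powersetCard (3 * (U.card - 1)),
      (((graphEdgeSets n m).filter (fun S => T ⊆ S)).card : ℝ)
        ≤ (graphEdgeSets n m).card * p ^ (3 * (U.card - 1)) := by
    intro U T hT
    rw [Finset.mem_powersetCard] at hT
    have := aux_count (auxE (Finset.univ : Finset (Fin n))) T m
      (hT.1.trans (fun e he => by rw [aux_mem_E] at he ⊢; simp [he.1])) (by rw [hEc]; exact hm)
    rw [hEc, hT.2, ← hGc, ← aux_graphEdgeSets] at this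
    convert this
  have hU : ∀ U : Finset (Fin n),
      ((((auxE U).powersetCard (3 * (U.card - 1))).biUnion
          (fun T => (graphEdgeSets n m).filter (fun S => T ⊆ S))).card : ℝ)
      ≤ (graphEdgeSets n m).card *
        (((U.card.choose 2).choose (3 * (U.card - 1)) : ℝ) * p ^ (3 * (U.card - 1))) := by
    intro U
    have h1 : ((((auxE U).powersetCard (3 * (U.card - 1))).biUnion
          (fun T => (graphEdgeSets n m).filter (fun S => T ⊆ S))).card : ℝ)
        ≤ ∑ T ∈ (auxE U).powersetCard (3 * (U.card - 1)),
          (((graphEdgeSets n m).filter (fun S => T ⊆ S)).card : ℝ) := by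
      exact_mod_cast Finset.card_biUnion_le
    refine h1.trans ((Finset.sum_le_sum (hcnt U)).trans (le_of_eq ?_))
    rw [Finset.sum_const, Finset.card_powersetCard, aux_card_E, nsmul_eq_mul]
    ring
  let g : ℕ → ℝ := fun s => if 2 ≤ s ∧ (s : ℝ) ≤ δ * n then
    (((s.choose 2).choose (3 * (s - 1)) : ℝ) * p ^ (3 * (s - 1))) else 0
  have hterm : ∀ s, (n.choose s : ℝ) * g s ≤ 4 * (3 * B ^ 3) ^ 2 / n * (s * (1 / 2) ^ s) := by
    intro s
    simp only [g]
    split_ifs with h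
    · exact aux_term n s B δ p hB hn h.1 hp0 hp hδ h.2
    · rw [mul_zero]; positivity
  calc _ ≤ ((X.biUnion (fun U => ((auxE U).powersetCard (3 * (U.card - 1))).biUnion
          (fun T => (graphEdgeSets n m).filter (fun S => T ⊆ S)))).card : ℝ) := by
        exact_mod_cast Finset.card_le_card hsub
    _ ≤ ∑ U ∈ X, ((((auxE U).powersetCard (3 * (U.card - 1))).biUnion
          (fun T => (graphEdgeSets n m).filter (fun S => T ⊆ S))).card : ℝ) := by
        exact_mod_cast Finset.card_biUnion_le
    _ ≤ ∑ U ∈ X, (graphEdgeSets n m).card *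
        (((U.card.choose 2).choose (3 * (U.card - 1)) : ℝ) * p ^ (3 * (U.card - 1))) :=
        Finset.sum_le_sum (fun U _ => hU U)
    _ = (graphEdgeSets n m).card * ∑ U ∈ (Finset.univ : Finset (Fin n)).powerset, g U.card := by
        rw [← Finset.mul_sum, hX, Finset.sum_filter]
    _ = (graphEdgeSets n m).card * ∑ s ∈ Finset.range (n + 1), (n.choose s : ℝ) * g s := by
        rw [Finset.sum_powerset_apply_card]; simp
    _ ≤ (graphEdgeSets n m).card *
          ∑ s ∈ Finset.range (n + 1), 4 * (3 * B ^ 3) ^ 2 / n * (s * (1 / 2) ^ s) := by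
        exact mul_le_mul_of_nonneg_left (Finset.sum_le_sum fun s _ => hterm s) (by positivity)
    _ ≤ (graphEdgeSets n m).card * (4 * (3 * B ^ 3) ^ 2 / n * 2) := by
        rw [← Finset.mul_sum, aux_sum]
        gcongr
        have : (0 : ℝ) ≤ 2 * ((n + 1 : ℕ) + 1) * (1 / 2) ^ (n + 1) := by positivity
        linarith
    _ = _ := by ring

open Classical in
lemma aux_gnm (n m : ℕ) (A : Set (Finset (Sym2 (Fin n)))) :
    gnm n m A = ((graphEdgeSets n m).card : ENNReal)⁻¹ *
      (((graphEdgeSets n m).filter (fun S => S ∈ A)).card : ENNReal) := by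
  simp only [gnm, Measure.smul_apply, Measure.finset_sum_apply, smul_eq_mul]
  congr 1
  have : ∀ S : Finset (Sym2 (Fin n)), Measure.dirac S A = if S ∈ A then (1 : ENNReal) else 0 := by
    intro S
    rw [Measure.dirac_apply' S (MeasurableSpace.measurableSet_top)]
    simp [Set.indicator_apply]
  simp only [this]
  simp

lemma aux_prob (n m : ℕ) (hm : m ≤ n.choose 2) (A : Set (Finset (Sym2 (Fin n)))) (ε : ℝ) (hε : 0 ≤ ε)
    (h : ∀ [DecidablePred fun S => ¬ S ∈ A],
      (((graphEdgeSets n m).filter (fun S => ¬ S ∈ A)).card : ℝ) ≤ (graphEdgeSets n m).card * ε) :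
    1 - ENNReal.ofReal ε ≤ gnm n m A ∧ gnm n m A ≤ 1 := by
  classical
  have h := @h _
  have hpos : 0 < (graphEdgeSets n m).card := by
    rw [aux_graphEdgeSets, Finset.card_powersetCard, aux_card_E]
    exact Nat.choose_pos (by simpa using hm)
  have hne : ((graphEdgeSets n m).card : ENNReal) ≠ 0 := by exact_mod_cast hpos.ne'
  have hnt : ((graphEdgeSets n m).card : ENNReal) ≠ ⊤ := ENNReal.natCast_ne_top _
  have hadd := Finset.card_filter_add_card_filter_not (s := graphEdgeSets n m) (fun S => S ∈ A)
  rw [aux_gnm]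
  constructor
  · rw [tsub_le_iff_right]
    have hb : (((graphEdgeSets n m).filter (fun S => ¬ S ∈ A)).card : ENNReal)
        ≤ (graphEdgeSets n m).card * ENNReal.ofReal ε := by
      rw [← ENNReal.ofReal_natCast, ← ENNReal.ofReal_natCast, ← ENNReal.ofReal_mul (by positivity)]
      exact ENNReal.ofReal_le_ofReal h
    calc (1 : ENNReal) = ((graphEdgeSets n m).card : ENNReal)⁻¹ * ((graphEdgeSets n m).card : ENNReal) :=
          (ENNReal.inv_mul_cancel hne hnt).symm
      _ = ((graphEdgeSets n m).card : ENNReal)⁻¹ *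
          ((((graphEdgeSets n m).filter (fun S => S ∈ A)).card : ENNReal) +
          (((graphEdgeSets n m).filter (fun S => ¬ S ∈ A)).card : ENNReal)) := by
          congr 1; exact_mod_cast hadd.symm
      _ ≤ ((graphEdgeSets n m).card : ENNReal)⁻¹ *
          ((((graphEdgeSets n m).filter (fun S => S ∈ A)).card : ENNReal) +
          (graphEdgeSets n m).card * ENNReal.ofReal ε) := by gcongr
      _ = _ := by
          rw [mul_add, ← mul_assoc, ENNReal.inv_mul_cancel hne hnt, one_mul]
  · calc _ ≤ ((graphEdgeSets n m).card : ENNReal)⁻¹ * ((graphEdgeSets n m).card : ENNReal) := by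
          gcongr; exact Finset.filter_subset _ _
      _ = 1 := ENNReal.inv_mul_cancel hne hnt

theorem stmt9 (k : ℕ) (hk : 2 < k) (c : ℝ) (hc : 0 < c) :
    ∃ δ : ℝ, 0 < δ ∧
      Tendsto (fun n : ℕ => gnm n ⌈c * n⌉₊
        {S : Finset (Sym2 (Fin n)) | ∀ C : Set (Fin n),
          DeepComponent k (graphOf S) C → C.ncard = 1 ∨ δ * n ≤ (C.ncard : ℝ)})
      atTop (nhds 1) := by
  set B : ℝ := 4 * (c + 1) with hBdef
  have hB : 1 ≤ B := by linarith
  have hB0 : 0 < B := by linarith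
  refine ⟨1 / (6 * B ^ 3), by positivity, ?_⟩
  have hδ : 3 * B ^ 3 * (1 / (6 * B ^ 3)) ^ 2 ≤ 1 / 2 := by
    have h3 : 1 ≤ B ^ 3 := one_le_pow₀ hB
    have : 3 * B ^ 3 * (1 / (6 * B ^ 3)) ^ 2 = 1 / (12 * B ^ 3) := by
      field_simp; norm_num
    rw [this, div_le_div_iff₀ (by positivity) (by norm_num)]
    linarith
  have hlim : Tendsto (fun n : ℕ => 1 - ENNReal.ofReal (8 * (3 * B ^ 3) ^ 2 / n)) atTop (nhds 1) := by
    have h1 : Tendsto (fun n : ℕ => ENNReal.ofReal (8 * (3 * B ^ 3) ^ 2 / n)) atTop (nhds 0) := by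
      rw [← ENNReal.ofReal_zero]
      exact ENNReal.tendsto_ofReal (tendsto_const_div_atTop_nhds_zero_nat _)
    have := ENNReal.Tendsto.sub (tendsto_const_nhds (x := (1 : ENNReal)) (f := atTop (α := ℕ))) h1 (Or.inl ENNReal.one_ne_top)
    simpa using this
  have hev : ∀ᶠ n : ℕ in atTop,
      1 - ENNReal.ofReal (8 * (3 * B ^ 3) ^ 2 / n) ≤ gnm n ⌈c * n⌉₊
        {S : Finset (Sym2 (Fin n)) | ∀ C : Set (Fin n),
          DeepComponent k (graphOf S) C → C.ncard = 1 ∨ 1 / (6 * B ^ 3) * n ≤ (C.ncard : ℝ)} ∧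
      gnm n ⌈c * n⌉₊
        {S : Finset (Sym2 (Fin n)) | ∀ C : Set (Fin n),
          DeepComponent k (graphOf S) C → C.ncard = 1 ∨ 1 / (6 * B ^ 3) * n ≤ (C.ncard : ℝ)} ≤ 1 := by
    filter_upwards [eventually_ge_atTop 2, eventually_ge_atTop ⌈B⌉₊] with n hn2 hnB
    have hn2' : (2 : ℝ) ≤ n := by exact_mod_cast hn2
    have hnB' : B ≤ n := Nat.ceil_le.1 hnB
    have hmle : (⌈c * n⌉₊ : ℝ) ≤ (c + 1) * n := by
      have := (Nat.ceil_lt_add_one (show 0 ≤ c * n by positivity)).le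
      linarith
    have hN : (n : ℝ) ^ 2 / 4 ≤ ((n.choose 2 : ℕ) : ℝ) := by
      rw [Nat.cast_choose_two]
      nlinarith
    have hm : ⌈c * n⌉₊ ≤ n.choose 2 := by
      have : (⌈c * n⌉₊ : ℝ) ≤ ((n.choose 2 : ℕ) : ℝ) := by
        refine hmle.trans (le_trans ?_ hN)
        nlinarith
      exact_mod_cast this
    have hp : (⌈c * n⌉₊ : ℝ) / (n.choose 2 : ℕ) ≤ B / n := by
      have hNpos : (0 : ℝ) < ((n.choose 2 : ℕ) : ℝ) := lt_of_lt_of_le (by positivity) hN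
      rw [div_le_div_iff₀ hNpos (by positivity)]
      calc (⌈c * n⌉₊ : ℝ) * n ≤ (c + 1) * n * n := by gcongr
        _ = B * ((n : ℝ) ^ 2 / 4) := by rw [hBdef]; ring
        _ ≤ _ := by gcongr
    apply aux_prob n _ hm _ _ (by positivity)
    intro _
    have := aux_bad k hk n _ B _ hB (by omega) hm hp hδ
    convert this using 3
    ext S
    simp only [Finset.mem_filter, Set.mem_ofPred_eq]
  exact tendsto_of_tendsto_of_tendsto_of_le_of_le' hlim tendsto_const_nhds
    (hev.mono fun _ h => h.1) (hev.mono fun _ h => h.2)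
end

section
/- For every integer k > 2 and every c > 0 there exists a constant K = K(c, k) such that, with high probability, the number of non-trivial k-deeply connected components of the uniform random graph G(n, ⌈cn⌉) is at most K. -/
open MeasureTheory Filter

/-! ### Deeply connected sets -/

lemma deeply_of_graphs {V : Type*} {k : ℕ} {G : SimpleGraph V} (H : Fin k → SimpleGraph V)
    (hle : ∀ i, H i ≤ G) (hc : ∀ i, (H i).Connected)
    (hd : ∀ i j, i ≠ j → ∀ u v, (H i).Adj u v → ¬ (H j).Adj u v) : DeeplyConnected k G := by
  choose T hT hTt using fun i => (hc i).exists_isTree_le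
  refine ⟨fun i => (T i).edgeSet, fun i => ?_, fun i => ?_, ?_⟩
  · exact SimpleGraph.edgeSet_mono ((hT i).trans (hle i))
  · unfold IsSpanningTreeSet
    rw [SimpleGraph.fromEdgeSet_edgeSet]
    exact ⟨(hTt i).1, (hTt i).2⟩
  · intro i j hij
    rw [Set.disjoint_left]
    intro e
    induction e using Sym2.ind with
    | _ u v =>
      intro h1 h2
      exact hd i j hij u v (hT i h1) (hT j h2)

lemma graphs_of_deeply {V : Type*} {k : ℕ} {G : SimpleGraph V} (h : DeeplyConnected k G) :
    ∃ H : Fin k → SimpleGraph V, (∀ i, H i ≤ G) ∧ (∀ i, (H i).IsTree) ∧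
      ∀ i j, i ≠ j → ∀ u v, (H i).Adj u v → ¬ (H j).Adj u v := by
  obtain ⟨T, hT, hs, hd⟩ := h
  refine ⟨fun i => SimpleGraph.fromEdgeSet (T i), fun i => ?_, fun i => ⟨(hs i).1, (hs i).2⟩, ?_⟩
  · intro u v huv
    exact hT i ((SimpleGraph.fromEdgeSet_adj _).1 huv).1
  · intro i j hij u v h1 h2
    exact Set.disjoint_left.1 (hd hij) ((SimpleGraph.fromEdgeSet_adj _).1 h1).1
      ((SimpleGraph.fromEdgeSet_adj _).1 h2).1

/-- The glued graph. -/
def glueGraph {V : Type*} {A B : Set V} (P : SimpleGraph A) (Q : SimpleGraph B) :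
    SimpleGraph (A ∪ B : Set V) where
  Adj u v := (∃ (hu : u.1 ∈ A) (hv : v.1 ∈ A), P.Adj ⟨u.1, hu⟩ ⟨v.1, hv⟩) ∨
    (¬ (u.1 ∈ A ∧ v.1 ∈ A) ∧ ∃ (hu : u.1 ∈ B) (hv : v.1 ∈ B), Q.Adj ⟨u.1, hu⟩ ⟨v.1, hv⟩)
  symm := ⟨by
    rintro u v (⟨hu, hv, h⟩ | ⟨hn, hu, hv, h⟩)
    · exact Or.inl ⟨hv, hu, h.symm⟩
    · exact Or.inr ⟨fun h' => hn ⟨h'.2, h'.1⟩, hv, hu, h.symm⟩⟩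
  loopless := ⟨by
    rintro u (⟨hu, hv, h⟩ | ⟨hn, hu, hv, h⟩)
    · exact P.loopless.irrefl _ h
    · exact Q.loopless.irrefl _ h⟩

lemma glueGraph_connected {V : Type*} {A B : Set V} (P : SimpleGraph A) (Q : SimpleGraph B)
    (hP : P.Connected) (hQ : Q.Connected) (x : V) (hA : x ∈ A) (hB : x ∈ B) :
    (glueGraph P Q).Connected := by
  have h1 : ∀ a (ha : a ∈ A), (glueGraph P Q).Reachable ⟨x, Or.inl hA⟩ ⟨a, Or.inl ha⟩ := by
    intro a ha
    let f : P →g glueGraph P Q :=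
      { toFun := fun u => ⟨u.1, Or.inl u.2⟩
        map_rel' := by
          intro u v h
          exact Or.inl ⟨u.2, v.2, h⟩ }
    exact (hP.preconnected ⟨x, hA⟩ ⟨a, ha⟩).map f
  have h2 : ∀ b : B, (glueGraph P Q).Reachable ⟨x, Or.inl hA⟩ ⟨b.1, Or.inr b.2⟩ := by
    intro b
    have h := (SimpleGraph.reachable_iff_reflTransGen _ _).1 (hQ.preconnected ⟨x, hB⟩ b)
    induction h with
    | refl => exact SimpleGraph.Reachable.refl _
    | @tail w b' _ hwb ih =>
      by_cases hb : w.1 ∈ A ∧ b'.1 ∈ A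
      · exact h1 _ hb.2
      · exact ih.trans (SimpleGraph.Adj.reachable (Or.inr ⟨hb, w.2, b'.2, hwb⟩))
  rw [SimpleGraph.connected_iff_exists_forall_reachable]
  refine ⟨⟨x, Or.inl hA⟩, ?_⟩
  rintro ⟨w, hw | hw⟩
  · exact h1 w hw
  · exact h2 ⟨w, hw⟩

lemma deeply_union {V : Type*} {k : ℕ} {G : SimpleGraph V} {A B : Set V} (x : V) (hA : x ∈ A)
    (hB : x ∈ B) (h1 : DeeplyConnected k (G.induce A)) (h2 : DeeplyConnected k (G.induce B)) :
    DeeplyConnected k (G.induce (A ∪ B)) := by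
  obtain ⟨P, hP, hPt, hPd⟩ := graphs_of_deeply h1
  obtain ⟨Q, hQ, hQt, hQd⟩ := graphs_of_deeply h2
  refine deeply_of_graphs (fun i => glueGraph (P i) (Q i)) (fun i => ?_)
    (fun i => glueGraph_connected _ _ (hPt i).1 (hQt i).1 x hA hB) ?_
  · rintro u v (⟨hu, hv, h⟩ | ⟨hn, hu, hv, h⟩)
    · exact hP i h
    · exact hQ i h
  · rintro i j hij u v (⟨hu, hv, h⟩ | ⟨hn, hu, hv, h⟩) (⟨hu', hv', h'⟩ | ⟨hn', hu', hv', h'⟩)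
    · exact hPd i j hij _ _ h h'
    · exact hn' ⟨hu, hv⟩
    · exact hn ⟨hu', hv'⟩
    · exact hQd i j hij _ _ h h'

lemma components_disjoint {V : Type*} {k : ℕ} {G : SimpleGraph V} {A B : Set V}
    (hA : DeepComponent k G A) (hB : DeepComponent k G B) (hne : A ≠ B) : Disjoint A B := by
  rw [Set.disjoint_left]
  intro x h1 h2
  have hu := deeply_union x h1 h2 hA.1 hB.1
  have e1 := hA.2 _ Set.subset_union_left hu
  have e2 := hB.2 _ Set.subset_union_right hu
  exact hne (e1.symm.trans e2)

lemma deeply_edges {V : Type*} [Fintype V] {k : ℕ} {G : SimpleGraph V} [Fintype G.edgeSet]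
    (h : DeeplyConnected k G) : k * (Fintype.card V - 1) ≤ G.edgeFinset.card := by
  classical
  obtain ⟨P, hP, hPt, hPd⟩ := graphs_of_deeply h
  have hdis : ((Finset.univ : Finset (Fin k)) : Set (Fin k)).PairwiseDisjoint
      fun i => (P i).edgeFinset := by
    intro i _ j _ hij
    rw [Function.onFun, Finset.disjoint_left]
    intro e
    induction e using Sym2.ind with
    | _ u v =>
      intro h1 h2
      rw [SimpleGraph.mem_edgeFinset] at h1 h2
      exact hPd i j hij u v h1 h2
  have hc := Finset.card_biUnion hdis
  have hs : (Finset.univ.biUnion fun i => (P i).edgeFinset) ⊆ G.edgeFinset := by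
    intro e he
    rw [Finset.mem_biUnion] at he
    obtain ⟨i, _, he⟩ := he
    rw [SimpleGraph.mem_edgeFinset] at he ⊢
    exact SimpleGraph.edgeSet_mono (hP i) he
  have hle := Finset.card_le_card hs
  rw [hc] at hle
  have : ∀ i, (P i).edgeFinset.card = Fintype.card V - 1 := fun i => by
    have := (hPt i).card_edgeFinset
    omega
  simp only [this, Finset.sum_const, Finset.card_univ, Fintype.card_fin, smul_eq_mul] at hle
  exact hle

lemma component_dense {n k : ℕ} (hk : 2 < k) (S : Finset (Sym2 (Fin n))) (U : Finset (Fin n))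
    (hU : 2 ≤ U.card) (h : DeeplyConnected k ((graphOf S).induce (U : Set (Fin n)))) :
    2 * U.card ≤ (S ∩ U.sym2).card := by
  classical
  have h1 := deeply_edges h
  have h2 := SimpleGraph.card_edgeFinset_le_card_choose_two
    (G := (graphOf S).induce (U : Set (Fin n)))
  have hcard : Fintype.card (U : Set (Fin n)) = U.card := by simp
  rw [hcard] at h1 h2
  have h3 : ((graphOf S).induce (U : Set (Fin n))).edgeFinset.card ≤ (S ∩ U.sym2).card := by
    apply Finset.card_le_card_of_injOn (Sym2.map Subtype.val)
    · intro e he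
      induction e using Sym2.ind with
      | _ u v =>
        rw [Finset.mem_coe, SimpleGraph.mem_edgeFinset, SimpleGraph.mem_edgeSet] at he
        have he' : (graphOf S).Adj u.1 v.1 := he
        have := ((SimpleGraph.fromEdgeSet_adj _).1 he').1
        rw [Sym2.map_mk, Finset.mem_coe, Finset.mem_inter]
        refine ⟨by simpa using this, ?_⟩
        rw [Finset.mk_mem_sym2_iff]
        exact ⟨u.2, v.2⟩
    · exact (Sym2.map.injective Subtype.val_injective).injOn
  have h4 : 3 * (U.card - 1) ≤ k * (U.card - 1) := Nat.mul_le_mul_right _ hk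
  rcases Nat.lt_or_ge U.card 3 with h5 | h5
  · have : U.card = 2 := by omega
    rw [this] at h1 h2 h4
    norm_num at h1 h2 h4
    omega
  · omega

lemma count_components {n k : ℕ} (hk : 2 < k) (S : Finset (Sym2 (Fin n))) (δ : ℝ) (hδ : 0 < δ)
    (hS : ∀ U : Finset (Fin n), 1 ≤ U.card → (U.card : ℝ) ≤ δ * n →
      ¬ 2 * U.card ≤ (S ∩ U.sym2).card) :
    {C : Set (Fin n) | DeepComponent k (graphOf S) C ∧ 2 ≤ C.ncard}.ncard ≤ ⌈1 / δ⌉₊ := by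
  classical
  set 𝒞 : Finset (Finset (Fin n)) := Finset.univ.filter fun U =>
    DeepComponent k (graphOf S) (U : Set (Fin n)) ∧ 2 ≤ U.card with h𝒞
  have heq : {C : Set (Fin n) | DeepComponent k (graphOf S) C ∧ 2 ≤ C.ncard} =
      (fun U : Finset (Fin n) => (U : Set (Fin n))) '' (𝒞 : Set (Finset (Fin n))) := by
    ext C
    constructor
    · rintro ⟨h1, h2⟩
      refine ⟨C.toFinset, ?_, by simp⟩
      rw [Set.ncard_eq_toFinset_card'] at h2
      simpa [h𝒞] using ⟨h1, by simpa using h2⟩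
    · rintro ⟨U, hU, rfl⟩
      simp only [h𝒞, Finset.coe_filter, Finset.mem_univ, true_and, Set.mem_ofPred_eq] at hU
      exact ⟨hU.1, by rw [Set.ncard_coe_finset]; exact hU.2⟩
  rw [heq, Set.ncard_image_of_injective _ Finset.coe_injective, Set.ncard_coe_finset]
  have hdis : (𝒞 : Set (Finset (Fin n))).PairwiseDisjoint id := by
    intro A hA B hB hAB
    simp only [h𝒞, Finset.coe_filter, Finset.mem_univ, true_and, Set.mem_ofPred_eq] at hA hB
    have := components_disjoint hA.1 hB.1 (fun h => hAB (Finset.coe_injective h))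
    simpa [Function.onFun] using this
  have hsum : ∑ U ∈ 𝒞, U.card ≤ n := by
    have := Finset.card_biUnion hdis
    simp only [id] at this
    rw [← this]
    simpa using Finset.card_le_univ (𝒞.biUnion id)
  have hbig : ∀ U ∈ 𝒞, δ * n ≤ (U.card : ℝ) := by
    intro U hU
    simp only [h𝒞, Finset.mem_filter, Finset.mem_univ, true_and] at hU
    by_contra hlt
    push Not at hlt
    exact hS U (by omega) hlt.le (component_dense hk S U hU.2 hU.1.1)
  have h1 : (𝒞.card : ℝ) * (δ * n) ≤ n := by
    have h2 := Finset.card_nsmul_le_sum 𝒞 (fun U => (U.card : ℝ)) (δ * n) hbig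
    rw [nsmul_eq_mul] at h2
    refine h2.trans ?_
    exact_mod_cast hsum
  rcases Finset.eq_empty_or_nonempty 𝒞 with h0 | ⟨U, hU⟩
  · simp [h0]
  · have hn : 0 < (n : ℝ) := by
      simp only [h𝒞, Finset.mem_filter, Finset.mem_univ, true_and] at hU
      have := Finset.card_le_univ U
      simp only [Fintype.card_fin] at this
      have : 0 < n := by omega
      exact_mod_cast this
    have h3 : (𝒞.card : ℝ) ≤ 1 / δ := by
      rw [le_div_iff₀ hδ]
      have : (𝒞.card : ℝ) * δ * n ≤ 1 * n := by linarith
      exact le_of_mul_le_mul_right this hn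
    exact_mod_cast h3.trans (Nat.le_ceil _)

/-! ### Counting -/

lemma choose_ratio (t : ℕ) : ∀ N m : ℕ, t ≤ m → m ≤ N →
    (N - t).choose (m - t) * N ^ t ≤ N.choose m * m ^ t := by
  induction t with
  | zero => intro N m _ _; simp
  | succ t ih =>
    intro N m htm hmN
    obtain ⟨m, rfl⟩ : ∃ m', m = m' + 1 := ⟨m - 1, by omega⟩
    obtain ⟨N, rfl⟩ : ∃ m', N = m' + 1 := ⟨N - 1, by omega⟩
    have h1 := ih (N + 1) (m + 1) (by omega) hmN
    have h2 := Nat.add_one_mul_choose_eq (N - t) (m - t)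
    rw [show N - t + 1 = N + 1 - t by omega, show m - t + 1 = m + 1 - t by omega] at h2
    rw [show N + 1 - (t + 1) = N - t by omega, show m + 1 - (t + 1) = m - t by omega]
    have h3 : (m + 1 - t) * (N + 1) ≤ (m + 1) * (N + 1 - t) := by
      zify [show t ≤ m + 1 by omega, show t ≤ N + 1 by omega]
      have : (t : ℤ) * m ≤ t * N := by
        have : (m : ℤ) ≤ N := by omega
        gcongr
      nlinarith
    have h4 : (N - t).choose (m - t) * (N + 1) ≤ (N + 1 - t).choose (m + 1 - t) * (m + 1) := by
      have hpos : 0 < N + 1 - t := by omega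
      apply Nat.le_of_mul_le_mul_left _ hpos
      calc (N + 1 - t) * ((N - t).choose (m - t) * (N + 1))
          = ((N + 1 - t) * (N - t).choose (m - t)) * (N + 1) := by ring
        _ = (N + 1 - t).choose (m + 1 - t) * ((m + 1 - t) * (N + 1)) := by rw [h2]; ring
        _ ≤ (N + 1 - t).choose (m + 1 - t) * ((m + 1) * (N + 1 - t)) := by gcongr
        _ = _ := by ring
    calc (N - t).choose (m - t) * (N + 1) ^ (t + 1)
        = ((N - t).choose (m - t) * (N + 1)) * (N + 1) ^ t := by ring
      _ ≤ ((N + 1 - t).choose (m + 1 - t) * (m + 1)) * (N + 1) ^ t := by gcongr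
      _ = ((N + 1 - t).choose (m + 1 - t) * (N + 1) ^ t) * (m + 1) := by ring
      _ ≤ ((N + 1).choose (m + 1) * (m + 1) ^ t) * (m + 1) := by gcongr
      _ = _ := by ring

lemma count_supersets {α : Type*} [DecidableEq α] (E F : Finset α) (m : ℕ) (hm : m ≤ E.card) :
    ((E.powersetCard m).filter fun S => F ⊆ S).card * E.card ^ F.card ≤
      E.card.choose m * m ^ F.card := by
  by_cases hF : F ⊆ E ∧ F.card ≤ m
  · refine le_trans ?_ (choose_ratio F.card E.card m hF.2 hm)
    gcongr
    rw [← Finset.card_sdiff_of_subset hF.1, ← Finset.card_powersetCard]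
    apply Finset.card_le_card_of_injOn (fun S => S \ F)
    · intro S hS
      simp only [Finset.coe_filter, Finset.mem_powersetCard, Set.mem_ofPred_eq] at hS
      rw [Finset.mem_coe, Finset.mem_powersetCard]
      refine ⟨Finset.sdiff_subset_sdiff hS.1.1 le_rfl, ?_⟩
      rw [Finset.card_sdiff_of_subset hS.2, hS.1.2]
    · intro S hS S' hS' heq
      simp only [Finset.coe_filter, Finset.mem_powersetCard, Set.mem_ofPred_eq] at hS hS'
      rw [← Finset.sdiff_union_of_subset hS.2, ← Finset.sdiff_union_of_subset hS'.2]
      simp only at heq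
      rw [heq]
  · have : ((E.powersetCard m).filter fun S => F ⊆ S) = ∅ := by
      rw [Finset.filter_eq_empty_iff]
      intro S hS hFS
      rw [Finset.mem_powersetCard] at hS
      exact hF ⟨hFS.trans hS.1, hS.2 ▸ Finset.card_le_card hFS⟩
    simp [this]

/-- Bad edge sets. -/
def badSet (n m : ℕ) (δ : ℝ) : Set (Finset (Sym2 (Fin n))) :=
  {S | S ∈ graphEdgeSets n m ∧ ∃ U : Finset (Fin n), 1 ≤ U.card ∧ (U.card : ℝ) ≤ δ * n ∧
    2 * U.card ≤ (S ∩ U.sym2).card}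

/-- The non-loop edges of the complete graph. -/
def allEdges (n : ℕ) : Finset (Sym2 (Fin n)) := Finset.univ.filter fun e => ¬ e.IsDiag

lemma card_allEdges (n : ℕ) : (allEdges n).card = n.choose 2 := by
  have := Sym2.card_subtype_not_diag (α := Fin n)
  rw [Fintype.card_subtype, Fintype.card_fin] at this
  exact this

lemma graphEdgeSets_eq (n m : ℕ) : graphEdgeSets n m = (allEdges n).powersetCard m := by
  ext S
  simp only [graphEdgeSets, allEdges, Finset.mem_filter, Finset.mem_univ, true_and,
    Finset.mem_powersetCard, Finset.subset_iff]
  tauto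

lemma bad_card (n m : ℕ) (δ : ℝ) (hm : m ≤ n.choose 2) (hN : 0 < n.choose 2) :
    ((badSet n m δ).ncard : ℝ) ≤ ∑ s ∈ Finset.Icc 1 ⌊δ * n⌋₊,
      (n.choose s : ℝ) * (((s + 1).choose 2).choose (2 * s) : ℝ) *
        ((n.choose 2).choose m * ((m : ℝ) / (n.choose 2)) ^ (2 * s)) := by
  classical
  have hsub : badSet n m δ ⊆ ((Finset.Icc 1 ⌊δ * n⌋₊).biUnion fun s =>
      ((Finset.univ : Finset (Fin n)).powersetCard s).biUnion fun U =>
        (U.sym2.powersetCard (2 * s)).biUnion fun F =>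
          ((allEdges n).powersetCard m).filter fun S => F ⊆ S : Finset (Finset (Sym2 (Fin n)))) := by
    rintro S ⟨hS, U, hU1, hU2, hU3⟩
    rw [graphEdgeSets_eq] at hS
    obtain ⟨F, hF, hFc⟩ := Finset.exists_subset_card_eq hU3
    simp only [Finset.mem_coe, Finset.mem_biUnion, Finset.mem_filter]
    refine ⟨U.card, ?_, U, ?_, F, ?_, hS, hF.trans Finset.inter_subset_left⟩
    · rw [Finset.mem_Icc]
      exact ⟨hU1, Nat.le_floor hU2⟩
    · simp [Finset.mem_powersetCard]
    · rw [Finset.mem_powersetCard]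
      exact ⟨hF.trans Finset.inter_subset_right, hFc⟩
  have h1 := Set.ncard_le_ncard hsub (Finset.finite_toSet _)
  rw [Set.ncard_coe_finset] at h1
  refine (Nat.cast_le.2 h1).trans ?_
  refine (Nat.cast_le.2 Finset.card_biUnion_le).trans ?_
  rw [Nat.cast_sum]
  refine Finset.sum_le_sum fun s _ => ?_
  refine (Nat.cast_le.2 Finset.card_biUnion_le).trans ?_
  rw [Nat.cast_sum, mul_assoc]
  refine (Finset.sum_le_card_nsmul _ _
    ((((s + 1).choose 2).choose (2 * s) : ℝ) *
        ((n.choose 2).choose m * ((m : ℝ) / (n.choose 2)) ^ (2 * s))) ?_).trans ?_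
  · intro U hU
    rw [Finset.mem_powersetCard] at hU
    refine (Nat.cast_le.2 Finset.card_biUnion_le).trans ?_
    rw [Nat.cast_sum]
    refine (Finset.sum_le_card_nsmul _ _
      ((n.choose 2).choose m * ((m : ℝ) / (n.choose 2)) ^ (2 * s)) ?_).trans ?_
    · intro F hF
      rw [Finset.mem_powersetCard] at hF
      have := count_supersets (allEdges n) F m (by rwa [card_allEdges])
      rw [card_allEdges, hF.2] at this
      have hN' : (0 : ℝ) < (n.choose 2 : ℝ) ^ (2 * s) := by positivity
      rw [div_pow, ← mul_div_assoc, le_div_iff₀ hN']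
      exact_mod_cast this
    · rw [Finset.card_powersetCard, Finset.card_sym2, hU.2, nsmul_eq_mul]
  · rw [Finset.card_powersetCard, Finset.card_univ, Fintype.card_fin, nsmul_eq_mul]

lemma pow_self_le (s : ℕ) : (s : ℝ) ^ s ≤ s.factorial * 3 ^ s := by
  have h1 := Real.pow_div_factorial_le_exp (s : ℝ) (Nat.cast_nonneg s) s
  have h2 : Real.exp (s : ℝ) ≤ 3 ^ s := by
    rw [← Real.exp_one_pow]
    have := Real.exp_one_lt_d9
    gcongr
    linarith
  have h3 : (0 : ℝ) < s.factorial := by positivity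
  rw [div_le_iff₀ h3] at h1
  nlinarith

lemma choose_bound (a s : ℕ) (hs : 1 ≤ s) : (a.choose s : ℝ) ≤ (3 * a / s) ^ s := by
  refine (Nat.choose_le_pow_div s a).trans ?_
  have h := pow_self_le s
  have h3 : (0 : ℝ) < s.factorial := by positivity
  have hs' : (0 : ℝ) < s := by exact_mod_cast hs
  rw [div_pow, div_le_div_iff₀ h3 (by positivity), mul_pow]
  have : (0 : ℝ) ≤ (a : ℝ) ^ s := by positivity
  nlinarith

lemma term_bound (n m s : ℕ) (c : ℝ) (hc : 0 < c) (hn : 2 ≤ n) (hs : 1 ≤ s)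
    (hm : (m : ℝ) ≤ (c + 1) * n) :
    (n.choose s : ℝ) * (((s + 1).choose 2).choose (2 * s) : ℝ) *
        ((m : ℝ) / (n.choose 2)) ^ (2 * s) ≤ (108 * (c + 1) ^ 2 * (s / n)) ^ s := by
  have hs' : (0 : ℝ) < s := by exact_mod_cast hs
  have hs1 : (1 : ℝ) ≤ s := by exact_mod_cast hs
  have hn2 : (2 : ℝ) ≤ n := by exact_mod_cast hn
  have h1 := choose_bound n s hs
  have h2 := choose_bound ((s + 1).choose 2) (2 * s) (by omega)
  have h3 : (((s + 1).choose 2 : ℕ) : ℝ) ≤ s ^ 2 := by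
    rw [Nat.cast_choose_two]
    push_cast
    nlinarith
  have h4 : (((s + 1).choose 2).choose (2 * s) : ℝ) ≤ (3 * s / 2) ^ (2 * s) := by
    refine h2.trans (pow_le_pow_left₀ (by positivity) ?_ _)
    push_cast
    rw [div_le_div_iff₀ (by positivity) (by norm_num)]
    nlinarith
  have h5 : ((m : ℝ) / (n.choose 2)) ≤ 4 * (c + 1) / n := by
    rw [Nat.cast_choose_two, div_le_div_iff₀ (by nlinarith) (by positivity)]
    calc (m : ℝ) * n ≤ (c + 1) * n * n := by gcongr
      _ = (c + 1) * (n * n) := by ring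
      _ ≤ (c + 1) * (4 * (n * (n - 1) / 2)) := by
        refine mul_le_mul_of_nonneg_left ?_ (by positivity)
        nlinarith
      _ = _ := by ring
  calc _ ≤ (3 * n / s : ℝ) ^ s * (3 * s / 2) ^ (2 * s) * (4 * (c + 1) / n) ^ (2 * s) := by gcongr
    _ = _ := by
      rw [pow_mul, pow_mul, ← mul_pow, ← mul_pow]
      congr 1
      field_simp
      ring

lemma bad_ratio (c : ℝ) (hc : 0 < c) : ∃ D : ℝ, ∀ n m : ℕ, 2 ≤ n → m ≤ n.choose 2 →
    (m : ℝ) ≤ (c + 1) * n →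
    ((badSet n m (1 / (216 * (c + 1) ^ 2))).ncard : ℝ) ≤ (n.choose 2).choose m * (D / n) := by
  have hsum : Summable fun s : ℕ => (s : ℝ) ^ 1 * (1 / 2 : ℝ) ^ s :=
    summable_pow_mul_geometric_of_norm_lt_one 1 (by norm_num)
  refine ⟨216 * (c + 1) ^ 2 * ∑' s : ℕ, (s : ℝ) ^ 1 * (1 / 2 : ℝ) ^ s, ?_⟩
  intro n m hn hmN hm
  have hn0 : (0 : ℝ) < n := by
    have : 0 < n := by omega
    exact_mod_cast this
  refine (bad_card n m _ hmN (Nat.choose_pos hn)).trans ?_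
  have hA : (0 : ℝ) < 108 * (c + 1) ^ 2 := by positivity
  set A : ℝ := 108 * (c + 1) ^ 2 with hAdef
  have hterm : ∀ s ∈ Finset.Icc 1 ⌊1 / (216 * (c + 1) ^ 2) * (n : ℝ)⌋₊,
      (n.choose s : ℝ) * (((s + 1).choose 2).choose (2 * s) : ℝ) *
        ((n.choose 2).choose m * ((m : ℝ) / (n.choose 2)) ^ (2 * s)) ≤
      ((n.choose 2).choose m * (2 * A / n)) * ((s : ℝ) ^ 1 * (1 / 2 : ℝ) ^ s) := by
    intro s hs
    rw [Finset.mem_Icc] at hs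
    have hs2 : (s : ℝ) ≤ 1 / (216 * (c + 1) ^ 2) * (n : ℝ) :=
      (Nat.cast_le.2 hs.2).trans (Nat.floor_le (by positivity))
    have hx : A * (s / n) ≤ 1 / 2 := by
      rw [show A * (s / n) = A * s / n by ring, div_le_iff₀ hn0]
      calc A * s ≤ A * (1 / (216 * (c + 1) ^ 2) * (n : ℝ)) := by gcongr
        _ = _ := by rw [hAdef]; field_simp; norm_num
    have hx0 : 0 ≤ A * (s / n) := by positivity
    have hb := term_bound n m s c hc hn hs.1 hm
    obtain ⟨r, rfl⟩ : ∃ r, s = r + 1 := ⟨s - 1, by omega⟩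
    have hb2 : (A * (((r + 1 : ℕ) : ℝ) / n)) ^ (r + 1) ≤
        (2 * A / n) * ((((r + 1 : ℕ) : ℝ)) ^ 1 * (1 / 2 : ℝ) ^ (r + 1)) := by
      rw [pow_succ]
      calc _ ≤ (1 / 2 : ℝ) ^ r * (A * (((r + 1 : ℕ) : ℝ) / n)) := by gcongr
        _ = _ := by rw [pow_succ]; ring
    calc _ = ((n.choose 2).choose m : ℝ) * ((n.choose (r + 1) : ℝ) *
          (((r + 1 + 1).choose 2).choose (2 * (r + 1)) : ℝ) *
          ((m : ℝ) / (n.choose 2)) ^ (2 * (r + 1))) := by ring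
      _ ≤ ((n.choose 2).choose m : ℝ) * ((2 * A / n) *
          ((((r + 1 : ℕ) : ℝ)) ^ 1 * (1 / 2 : ℝ) ^ (r + 1))) := by
        exact mul_le_mul_of_nonneg_left (hb.trans hb2) (by positivity)
      _ = _ := by ring
  refine (Finset.sum_le_sum hterm).trans ?_
  rw [← Finset.mul_sum]
  have hle := hsum.sum_le_tsum (Finset.Icc 1 ⌊1 / (216 * (c + 1) ^ 2) * (n : ℝ)⌋₊)
    (fun s _ => by positivity)
  calc _ ≤ ((n.choose 2).choose m * (2 * A / n)) * ∑' s : ℕ, (s : ℝ) ^ 1 * (1 / 2 : ℝ) ^ s := by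
        gcongr
    _ = _ := by rw [hAdef]; ring

/-! ### The measure -/

lemma gnm_apply (n m : ℕ) (A : Set (Finset (Sym2 (Fin n)))) :
    gnm n m A = ((graphEdgeSets n m).card : ENNReal)⁻¹ * ((A ∩ graphEdgeSets n m).ncard : ENNReal) := by
  classical
  have hA : MeasurableSet A := trivial
  rw [gnm, Measure.smul_apply, Measure.finsetSum_apply, smul_eq_mul]
  congr 1
  simp only [Measure.dirac_apply' _ hA, Set.indicator_apply, Pi.one_apply]
  rw [Finset.sum_boole]
  congr 1
  rw [← Set.ncard_coe_finset]
  congr 1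
  ext S
  simp [and_comm]

lemma gnm_prob (n m : ℕ) (hm : m ≤ n.choose 2) : IsProbabilityMeasure (gnm n m) := by
  constructor
  rw [gnm_apply, Set.univ_inter, Set.ncard_coe_finset]
  apply ENNReal.inv_mul_cancel
  · rw [graphEdgeSets_eq, Finset.card_powersetCard, card_allEdges]
    exact_mod_cast (Nat.choose_pos hm).ne'
  · exact ENNReal.natCast_ne_top _

theorem stmt10 (k : ℕ) (hk : 2 < k) (c : ℝ) (hc : 0 < c) :
    ∃ K : ℕ, Tendsto (fun n : ℕ => gnm n ⌈c * n⌉₊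
        {S : Finset (Sym2 (Fin n)) |
          {C : Set (Fin n) | DeepComponent k (graphOf S) C ∧ 2 ≤ C.ncard}.ncard ≤ K})
      atTop (nhds 1) := by
  obtain ⟨D, hD⟩ := bad_ratio c hc
  set δ : ℝ := 1 / (216 * (c + 1) ^ 2) with hδ
  have hδ0 : 0 < δ := by positivity
  refine ⟨⌈1 / δ⌉₊, ?_⟩
  have hlim : Tendsto (fun n : ℕ => 1 - ENNReal.ofReal (D / n)) atTop (nhds 1) := by
    have h0 : Tendsto (fun n : ℕ => D / (n : ℝ)) atTop (nhds 0) :=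
      tendsto_const_div_atTop_nhds_zero_nat D
    have h1 := ENNReal.tendsto_ofReal h0
    rw [ENNReal.ofReal_zero] at h1
    have h2 := ENNReal.Tendsto.sub (tendsto_const_nhds (x := (1 : ENNReal))) h1
      (Or.inl ENNReal.one_ne_top)
    simpa using h2
  have hev : ∀ᶠ n : ℕ in atTop, 2 ≤ n ∧ ⌈c * n⌉₊ ≤ n.choose 2 ∧
      ((⌈c * n⌉₊ : ℕ) : ℝ) ≤ (c + 1) * n := by
    filter_upwards [eventually_ge_atTop 2, eventually_ge_atTop (⌈2 * (c + 1) + 1⌉₊)] with n h1 h2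
    have hn2 : (2 : ℝ) ≤ n := by exact_mod_cast h1
    have h3 : 2 * (c + 1) + 1 ≤ (n : ℝ) := (Nat.le_ceil _).trans (by exact_mod_cast h2)
    have h4 : ((⌈c * n⌉₊ : ℕ) : ℝ) ≤ (c + 1) * n := by
      have := (Nat.ceil_lt_add_one (show 0 ≤ c * (n : ℝ) by positivity)).le
      nlinarith
    refine ⟨h1, ?_, h4⟩
    have h5 : ((⌈c * n⌉₊ : ℕ) : ℝ) ≤ ((n.choose 2 : ℕ) : ℝ) := by
      rw [Nat.cast_choose_two]
      nlinarith
    exact_mod_cast h5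
  refine tendsto_of_tendsto_of_tendsto_of_le_of_le' hlim tendsto_const_nhds ?_ ?_
  · filter_upwards [hev] with n hn
    obtain ⟨h1, h2, h3⟩ := hn
    have := gnm_prob n _ h2
    set G := {S : Finset (Sym2 (Fin n)) |
          {C : Set (Fin n) | DeepComponent k (graphOf S) C ∧ 2 ≤ C.ncard}.ncard ≤ ⌈1 / δ⌉₊} with hG
    have hcompl : gnm n ⌈c * n⌉₊ Gᶜ ≤ ENNReal.ofReal (D / n) := by
      have hsub : Gᶜ ∩ (graphEdgeSets n ⌈c * n⌉₊ : Set (Finset (Sym2 (Fin n)))) ⊆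
          badSet n ⌈c * n⌉₊ δ := by
        rintro S ⟨hS, hS'⟩
        refine ⟨hS', ?_⟩
        by_contra hno
        push Not at hno
        exact hS (count_components hk S δ hδ0 fun U hU1 hU2 => not_le.2 (hno U hU1 hU2))
      have hle : ((Gᶜ ∩ (graphEdgeSets n ⌈c * n⌉₊ : Set (Finset (Sym2 (Fin n))))).ncard : ℝ) ≤
          (n.choose 2).choose ⌈c * n⌉₊ * (D / n) :=
        (Nat.cast_le.2 (Set.ncard_le_ncard hsub (Set.toFinite _))).trans (hD n _ h1 h2 h3)
      rw [gnm_apply, graphEdgeSets_eq, Finset.card_powersetCard, card_allEdges,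
        ← graphEdgeSets_eq]
      have hpos := Nat.choose_pos h2
      rw [ENNReal.inv_mul_le_iff (by exact_mod_cast hpos.ne') (ENNReal.natCast_ne_top _)]
      rw [← ENNReal.ofReal_natCast, ← ENNReal.ofReal_natCast, ← ENNReal.ofReal_mul (by positivity)]
      exact ENNReal.ofReal_le_ofReal hle
    have hGm : MeasurableSet G := trivial
    have hadd := prob_add_prob_compl (μ := gnm n ⌈c * n⌉₊) hGm
    rw [tsub_le_iff_right, ← hadd]
    gcongr
  · filter_upwards [hev] with n hn
    have := gnm_prob n _ hn.2.1
    exact prob_le_one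
end
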